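/- For all integers n, k, j ≥ 1 and l ≥ 0, the number of set partitions of [2(n+k+j)−1+l] with exactly l singleton blocks such that the first and last elements are not singletons and the non-singleton vertices, read in increasing order, have standard-representation types 'opener' for the first n+k of them, then 'closer' for the next k−1, then one 'transitory', then 'opener' for the next j−1, then 'closer' for the last n+j, equals n! · binom(n+k, k) · k! · binom(n+j, j) · j! · binom(2(n+k+j−1)+l−1, l). -/

import Mathlib

/-- The set of arc endpoints of a collection of arcs. -/
def Endpoints (M : Finset (ℕ × ℕ)) : Finset ℕ := M.image Prod.fst ∪ M.image Prod.snd

/-- A partial matching of `[N] = {1,…,N}`: a set of arcs `(i,j)` with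
`1 ≤ i < j ≤ N` whose entries are pairwise disjoint. -/
def IsPartialMatching (N : ℕ) (M : Finset (ℕ × ℕ)) : Prop :=
  (∀ p ∈ M, 1 ≤ p.1 ∧ p.1 < p.2 ∧ p.2 ≤ N) ∧
  (∀ p ∈ M, ∀ q ∈ M, p ≠ q → p.1 ≠ q.1 ∧ p.1 ≠ q.2 ∧ p.2 ≠ q.1 ∧ p.2 ≠ q.2)

/-- A perfect matching of `[N]`: a partial matching whose arcs cover `{1,…,N}`. -/
def IsPerfectMatching (N : ℕ) (M : Finset (ℕ × ℕ)) : Prop :=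
  IsPartialMatching N M ∧ Endpoints M = Finset.Icc 1 N

/-- `A` is a `k`-crossing of `M`: a `k`-element subset of arcs listable as
`(i₁,j₁),…,(i_k,j_k)` with `i₁ < ⋯ < i_k < j₁ < ⋯ < j_k`. -/
def IsCrossing (k : ℕ) (M A : Finset (ℕ × ℕ)) : Prop :=
  A ⊆ M ∧ A.card = k ∧ (∀ p ∈ A, ∀ q ∈ A, p.1 < q.1 → p.2 < q.2) ∧
    (∀ p ∈ A, ∀ q ∈ A, p.1 < q.2)

/-- `A` is a `k`-nesting of `M`: a `k`-element subset of arcs listable as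
`(i₁,j₁),…,(i_k,j_k)` with `i₁ < ⋯ < i_k < j_k < ⋯ < j₁`. -/
def IsNesting (k : ℕ) (M A : Finset (ℕ × ℕ)) : Prop :=
  A ⊆ M ∧ A.card = k ∧ (∀ p ∈ A, ∀ q ∈ A, p.1 < q.1 → q.2 < p.2)

/-- `crNum k M` : the number of `k`-crossings of `M`. -/
noncomputable def crNum (k : ℕ) (M : Finset (ℕ × ℕ)) : ℕ :=
  Nat.card {A : Finset (ℕ × ℕ) // IsCrossing k M A}

/-- `neNum k M` : the number of `k`-nestings of `M`. -/
noncomputable def neNum (k : ℕ) (M : Finset (ℕ × ℕ)) : ℕ :=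
  Nat.card {A : Finset (ℕ × ℕ) // IsNesting k M A}

/-- The four types of vertices in the standard representation of a set partition. -/
inductive VType
  | opener | closer | transitory | fixedpt
deriving DecidableEq

/-- The arc set of the standard representation of a set partition `P` of `{1,…,N}`:
arcs join consecutive elements of a block. -/
def spArcs {N : ℕ} (P : Finpartition (Finset.Icc (1 : ℕ) N)) : Finset (ℕ × ℕ) :=
  ((Finset.Icc (1 : ℕ) N) ×ˢ (Finset.Icc (1 : ℕ) N)).filter fun q =>
    q.1 < q.2 ∧ ∃ B ∈ P.parts, q.1 ∈ B ∧ q.2 ∈ B ∧ ∀ x ∈ B, ¬(q.1 < x ∧ x < q.2)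

/-- The type of the vertex `i` in the standard representation of `P`. -/
def vtype {N : ℕ} (P : Finpartition (Finset.Icc (1 : ℕ) N)) (i : ℕ) : VType :=
  if i ∈ (spArcs P).image Prod.fst then
    (if i ∈ (spArcs P).image Prod.snd then VType.transitory else VType.opener)
  else
    (if i ∈ (spArcs P).image Prod.snd then VType.closer else VType.fixedpt)

/-- The (1-based) rank of `i` inside the finite set `E`. -/
def rankIn (E : Finset ℕ) (i : ℕ) : ℕ := (E.filter fun x => x ≤ i).card

/-- The last vertex of the descending path `i, p i, p (p i), …`, which stops at the first vertex
that `p` does not strictly decrease. -/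
def descentRoot (p : ℕ → ℕ) (i : ℕ) : ℕ :=
  if p i < i then descentRoot p (p i) else i
termination_by i

lemma descentRoot_apply {p : ℕ → ℕ} {i : ℕ} (h : p i < i) :
    descentRoot p (p i) = descentRoot p i := by
  conv_rhs => rw [descentRoot, if_pos h]

lemma descentRoot_of_le {p : ℕ → ℕ} {i : ℕ} (h : i ≤ p i) : descentRoot p i = i := by
  rw [descentRoot, if_neg h.not_gt]

lemma descentRoot_le (p : ℕ → ℕ) (i : ℕ) : descentRoot p i ≤ i := by
  induction i using Nat.strong_induction_on with
  | _ i ih =>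
    rcases lt_or_ge (p i) i with h | h
    · rw [← descentRoot_apply h]
      exact (ih _ h).trans h.le
    · exact (descentRoot_of_le h).le

/-- If `p` is injective where it strictly decreases, then `p y` and `y` are consecutive in the
fibre of `descentRoot p`. -/
lemma descentRoot_ne_of_between {p : ℕ → ℕ}
    (hp : ∀ a b, p a < a → p b < b → p a = p b → a = b) {x y : ℕ} (hx : p y < x) (hy : x < y) :
    descentRoot p x ≠ descentRoot p y := by
  induction y using Nat.strong_induction_on generalizing x with
  | _ y ihy =>
    induction x using Nat.strong_induction_on with
    | _ x ihx =>
      have hyy : p y < y := hx.trans hy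
      rcases lt_or_ge (p x) x with h | h
      · rcases lt_trichotomy (p x) (p y) with h' | h' | h'
        · rw [← descentRoot_apply hyy]
          exact (ihy x hy h' hx).symm
        · exact absurd (hp x y h hyy h') hy.ne
        · rw [← descentRoot_apply h]
          exact ihx _ h h' (h.trans hy)
      · rw [descentRoot_of_le h, ← descentRoot_apply hyy]
        exact ((descentRoot_le p (p y)).trans_lt hx).ne'

/-- The partition of `{1,…,N}` into the fibres of `descentRoot p`. -/
def descentPartition (N : ℕ) (p : ℕ → ℕ) : Finpartition (Finset.Icc (1 : ℕ) N) :=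
  letI : DecidableRel (Setoid.ker (descentRoot p)).r :=
    fun a b => decEq (descentRoot p a) (descentRoot p b)
  Finpartition.ofSetSetoid (Setoid.ker (descentRoot p)) (Finset.Icc 1 N)

lemma mem_part_descentPartition {N : ℕ} {p : ℕ → ℕ} {a b : ℕ} :
    b ∈ (descentPartition N p).part a ↔
      a ∈ Finset.Icc 1 N ∧ b ∈ Finset.Icc 1 N ∧ descentRoot p a = descentRoot p b := by
  let : DecidableRel (Setoid.ker (descentRoot p)).r :=
    fun a b => decEq (descentRoot p a) (descentRoot p b)
  exact Finpartition.mem_part_ofSetSetoid_iff_rel _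

lemma mem_spArcs {N : ℕ} {P : Finpartition (Finset.Icc (1 : ℕ) N)} {a b : ℕ} :
    (a, b) ∈ spArcs P ↔ a < b ∧ a ∈ P.part b ∧ ∀ x ∈ P.part b, ¬(a < x ∧ x < b) := by
  simp only [spArcs, Finset.mem_filter, Finset.mem_product]
  constructor
  · rintro ⟨-, hab, B, hB, ha, hb, h⟩
    rw [P.part_eq_of_mem hB hb]
    exact ⟨hab, ha, h⟩
  · rintro ⟨hab, ha, h⟩
    have hb : b ∈ Finset.Icc 1 N := P.part_nonempty.1 ⟨a, ha⟩
    exact ⟨⟨P.part_subset b ha, hb⟩, hab, P.part b, P.part_mem.2 hb, ha, P.mem_part hb, h⟩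

lemma mem_spArcs_descentPartition {N : ℕ} {p : ℕ → ℕ}
    (hp : ∀ a b, p a < a → p b < b → p a = p b → a = b) {a b : ℕ} :
    (a, b) ∈ spArcs (descentPartition N p) ↔
      a ∈ Finset.Icc 1 N ∧ b ∈ Finset.Icc 1 N ∧ a < b ∧ p b = a := by
  simp only [mem_spArcs, mem_part_descentPartition]
  constructor
  · rintro ⟨hab, ⟨hb, ha, hr⟩, h⟩
    refine ⟨ha, hb, hab, ?_⟩
    have hbb : p b < b := by
      by_contra! hcon
      rw [descentRoot_of_le hcon] at hr
      have := descentRoot_le p a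
      omega
    rcases lt_trichotomy (p b) a with h' | h' | h'
    · exact absurd hr.symm (descentRoot_ne_of_between hp h' hab)
    · exact h'
    · refine absurd ⟨h', hbb⟩ (h (p b) ⟨hb, ?_, (descentRoot_apply hbb).symm⟩)
      simp only [Finset.mem_Icc] at ha hb ⊢
      omega
  · rintro ⟨ha, hb, hab, rfl⟩
    refine ⟨hab, ⟨hb, ha, (descentRoot_apply hab).symm⟩, ?_⟩
    rintro x ⟨-, -, hx⟩ ⟨h1, h2⟩
    exact descentRoot_ne_of_between hp h1 h2 hx.symm

lemma spArcs_left_unique {N : ℕ} {P : Finpartition (Finset.Icc (1 : ℕ) N)} {a a' b : ℕ}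
    (h : (a, b) ∈ spArcs P) (h' : (a', b) ∈ spArcs P) : a = a' := by
  rw [mem_spArcs] at h h'
  have h1 := h.2.2 a' h'.2.1
  have h2 := h'.2.2 a h.2.1
  omega

lemma spArcs_right_unique {N : ℕ} {P : Finpartition (Finset.Icc (1 : ℕ) N)} {a b b' : ℕ}
    (h : (a, b) ∈ spArcs P) (h' : (a, b') ∈ spArcs P) : b = b' := by
  rw [mem_spArcs] at h h'
  have hb := P.part_nonempty.1 ⟨a, h.2.1⟩
  have hb' := P.part_nonempty.1 ⟨a, h'.2.1⟩
  have e : P.part b = P.part b' :=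
    (P.part_eq_of_mem (P.part_mem.2 hb) h.2.1).symm.trans
      (P.part_eq_of_mem (P.part_mem.2 hb') h'.2.1)
  have h1 := h.2.2 b' (e ▸ P.mem_part hb')
  have h2 := h'.2.2 b (e ▸ P.mem_part hb)
  omega

/-- Every vertex that is not the least one of its block is the right endpoint of an arc. -/
lemma exists_mem_spArcs {N : ℕ} {P : Finpartition (Finset.Icc (1 : ℕ) N)} {x y : ℕ}
    (hx : x ∈ P.part y) (hxy : x < y) : ∃ z, x ≤ z ∧ (z, y) ∈ spArcs P := by
  have hne : ((P.part y).filter (· < y)).Nonempty := ⟨x, by simp [hx, hxy]⟩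
  have hz := Finset.max'_mem _ hne
  have hmax := Finset.le_max' ((P.part y).filter (· < y))
  set z := ((P.part y).filter (· < y)).max' hne
  simp only [Finset.mem_filter] at hz hmax
  refine ⟨z, hmax x ⟨hx, hxy⟩, mem_spArcs.2 ⟨hz.2, hz.1, fun w hw h => ?_⟩⟩
  exact absurd (hmax w ⟨hw, h.2⟩) (not_le.2 h.1)

lemma mem_part_of_spArcs_subset {N : ℕ} {P Q : Finpartition (Finset.Icc (1 : ℕ) N)}
    (h : spArcs P ⊆ spArcs Q) {x y : ℕ} (hx : x ∈ P.part y) : x ∈ Q.part y := by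
  wlog hxy : x ≤ y generalizing x y
  · have hy := P.part_nonempty.1 ⟨x, hx⟩
    have hx' := P.part_subset y hx
    rw [Finpartition.mem_part_iff_part_eq_part _ hx' hy] at hx ⊢
    refine ((Finpartition.mem_part_iff_part_eq_part _ hy hx').1 (this ?_ (by omega))).symm
    rw [Finpartition.mem_part_iff_part_eq_part _ hy hx']
    exact hx.symm
  induction y using Nat.strong_induction_on with
  | _ y ih =>
    have hy := P.part_nonempty.1 ⟨x, hx⟩
    rcases hxy.eq_or_lt with rfl | hlt
    · exact Q.mem_part hy
    · obtain ⟨z, hxz, hz⟩ := exists_mem_spArcs hx hlt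
      have hzP := mem_spArcs.1 hz
      have hzQ := mem_spArcs.1 (h hz)
      have eP := P.part_eq_of_mem (P.part_mem.2 hy) hzP.2.1
      have eQ := Q.part_eq_of_mem (Q.part_mem.2 hy) hzQ.2.1
      rw [← eQ]
      exact ih z hzP.1 (eP ▸ hx) hxz

lemma spArcs_injective {N : ℕ} :
    Function.Injective (spArcs : Finpartition (Finset.Icc (1 : ℕ) N) → _) := by
  have key : ∀ P Q : Finpartition (Finset.Icc (1 : ℕ) N), spArcs P = spArcs Q →
      P.parts ⊆ Q.parts := by
    intro P Q h B hB
    obtain ⟨y, hy⟩ := P.nonempty_of_mem_parts hB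
    have hyN : y ∈ Finset.Icc 1 N := P.le hB hy
    have : B = Q.part y := by
      rw [← P.part_eq_of_mem hB hy]
      ext x
      exact ⟨mem_part_of_spArcs_subset h.le, mem_part_of_spArcs_subset h.ge⟩
    rw [this]
    exact Q.part_mem.2 hyN
  intro P Q h
  exact Finpartition.ext ((key P Q h).antisymm (key Q P h.symm))

/-- Partitions with prescribed sets of left and right endpoints of arcs are counted by the
strictly decreasing injections from the right endpoints into the left endpoints. -/
lemma card_partitions_with_endpoints {N : ℕ} {L R : Finset ℕ} (hL : L ⊆ Finset.Icc 1 N)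
    (hR : R ⊆ Finset.Icc 1 N) (hLR : R.card = L.card) :
    Nat.card {P : Finpartition (Finset.Icc (1 : ℕ) N) //
      (spArcs P).image Prod.fst = L ∧ (spArcs P).image Prod.snd = R} =
    Nat.card {f : R ↪ L // ∀ r, (f r : ℕ) < r} := by
  classical
  let pred (f : R ↪ L) (i : ℕ) : ℕ := if h : i ∈ R then f ⟨i, h⟩ else i
  have pred_mem (f : R ↪ L) (r : R) : pred f r = f r := by simp [pred]
  have mem_of_pred (f : R ↪ L) (i : ℕ) (h : pred f i < i) : i ∈ R := by
    by_contra hi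
    simp [pred, hi] at h
  have hinj (f : R ↪ L) (a b : ℕ) (ha : pred f a < a) (hb : pred f b < b)
      (hab : pred f a = pred f b) : a = b := by
    have h := hab
    rw [pred_mem f ⟨a, mem_of_pred f a ha⟩, pred_mem f ⟨b, mem_of_pred f b hb⟩] at h
    simpa using f.injective (Subtype.ext h)
  have arcs (f : R ↪ L) (hf : ∀ r, (f r : ℕ) < r) (a b : ℕ) :
      (a, b) ∈ spArcs (descentPartition N (pred f)) ↔ ∃ h : b ∈ R, (f ⟨b, h⟩ : ℕ) = a := by
    rw [mem_spArcs_descentPartition (hinj f)]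
    constructor
    · rintro ⟨-, -, h, h'⟩
      have hb := mem_of_pred f b (h'.trans_lt h)
      exact ⟨hb, by rw [← h']; exact (pred_mem f ⟨b, hb⟩).symm⟩
    · rintro ⟨hb, rfl⟩
      exact ⟨hL (f _).2, hR hb, hf _, pred_mem f ⟨b, hb⟩⟩
  symm
  refine Nat.card_congr (Equiv.ofBijective
    (fun f => ⟨descentPartition N (pred f.1), ?_, ?_⟩) ⟨?_, ?_⟩)
  · ext a
    simp only [Finset.mem_image, Prod.exists, exists_and_right, exists_eq_right, arcs f.1 f.2]
    constructor
    · rintro ⟨b, hb, h⟩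
      have := (f.1 ⟨b, hb⟩).2
      rwa [h] at this
    · intro ha
      have hsurj : Function.Surjective f.1 :=
        ((Fintype.bijective_iff_injective_and_card f.1).2 ⟨f.1.injective, by simpa using hLR⟩).2
      obtain ⟨r, hr⟩ := hsurj ⟨a, ha⟩
      exact ⟨r, r.2, by simp [hr]⟩
  · ext b
    simp only [Finset.mem_image, Prod.exists, exists_eq_right, arcs f.1 f.2]
    exact ⟨fun ⟨_, h, _⟩ => h, fun h => ⟨f.1 ⟨b, h⟩, h, rfl⟩⟩
  · intro f g hfg
    have h : spArcs (descentPartition N (pred f.1)) = spArcs (descentPartition N (pred g.1)) := by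
      rw [Subtype.mk.inj hfg]
    ext r
    have hr := (arcs f.1 f.2 (f.1 r) r).2 ⟨r.2, rfl⟩
    rw [h, arcs g.1 g.2] at hr
    exact hr.2.symm
  · rintro ⟨P, hPL, hPR⟩
    have hex : ∀ r : R, ∃ a : L, ((a : ℕ), (r : ℕ)) ∈ spArcs P := by
      rintro ⟨r, hr⟩
      rw [← hPR] at hr
      obtain ⟨⟨a, b⟩, hab, rfl⟩ := Finset.mem_image.1 hr
      exact ⟨⟨a, hPL ▸ Finset.mem_image_of_mem Prod.fst hab⟩, hab⟩
    choose f hf using hex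
    let F : R ↪ L := ⟨f, fun r s hrs =>
      Subtype.ext (spArcs_right_unique (hf r) (hrs ▸ hf s))⟩
    have hF : ∀ r, (F r : ℕ) < r := fun r => (mem_spArcs.1 (hf r)).1
    refine ⟨⟨F, hF⟩, Subtype.ext (spArcs_injective ?_)⟩
    ext ⟨a, b⟩
    refine (arcs F hF a b).trans ⟨?_, fun h => ?_⟩
    · rintro ⟨hb, rfl⟩
      exact hf ⟨b, hb⟩
    · have hb : b ∈ R := hPR ▸ Finset.mem_image_of_mem Prod.snd h
      exact ⟨hb, spArcs_left_unique (hf ⟨b, hb⟩) h⟩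

/-- Injections between finite types of equal cardinality that map the elements satisfying `p` to
elements satisfying `q`. -/
lemma card_embedding_restricted {α β : Type*} [Fintype α] [Fintype β] (p : α → Prop)
    (q : β → Prop) (h : Fintype.card α = Fintype.card β) :
    Nat.card {f : α ↪ β // ∀ a, p a → q (f a)} =
      (Nat.card {b // q b}).descFactorial (Nat.card {a // p a}) *
        (Nat.card {a // ¬p a}).factorial := by
  classical
  let e₁ : (α ↪ β) ≃ Σ g : {a // p a} ↪ β, {a // ¬p a} ↪ ↥(Set.range g)ᶜ :=
    ((Equiv.sumCompl p).symm.embeddingCongr (Equiv.refl β)).trans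
      Equiv.sumEmbeddingEquivSigmaEmbeddingRestricted
  have he₁ (f : α ↪ β) (a : {a // p a}) : (e₁ f).1 a = f a := rfl
  let e₂ : {f : α ↪ β // ∀ a, p a → q (f a)} ≃
      {x : Σ g : {a // p a} ↪ β, {a // ¬p a} ↪ ↥(Set.range g)ᶜ // ∀ a, q (x.1 a)} :=
    e₁.subtypeEquiv fun f => by simp [he₁]
  let e₃ := Equiv.subtypeSigmaEquiv
    (fun g : {a // p a} ↪ β => {a // ¬p a} ↪ ↥(Set.range g)ᶜ) (fun g => ∀ a, q (g a))
  let e₄ : {g : {a // p a} ↪ β // ∀ a, q (g a)} ≃ ({a // p a} ↪ {b // q b}) :=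
    Equiv.codRestrict _ _
  rw [Nat.card_congr (e₂.trans e₃), Nat.card_sigma]
  have hfib (g : {g : {a // p a} ↪ β // ∀ a, q (g a)}) :
      Nat.card ({a // ¬p a} ↪ ↥(Set.range g.1)ᶜ) = (Nat.card {a // ¬p a}).factorial := by
    have hc : Fintype.card ↥(Set.range g.1)ᶜ = Fintype.card {a // ¬p a} := by
      rw [Fintype.card_compl_set, Set.card_range_of_injective g.1.injective,
        Fintype.card_subtype_compl, h]
    rw [Nat.card_eq_fintype_card, Fintype.card_embedding_eq, hc, Nat.descFactorial_self,
      Nat.card_eq_fintype_card]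
  rw [Finset.sum_congr rfl fun g _ => hfib g, Finset.sum_const, Finset.card_univ, smul_eq_mul,
    ← Nat.card_eq_fintype_card, Nat.card_congr e₄]
  simp only [Nat.card_eq_fintype_card, Fintype.card_embedding_eq]

lemma rankIn_lt_rankIn {E : Finset ℕ} {x y : ℕ} (hy : y ∈ E) :
    rankIn E x < rankIn E y ↔ x < y := by
  constructor
  · intro h
    by_contra! hyx
    refine absurd h (not_lt.2 (Finset.card_le_card fun z hz => ?_))
    simp only [Finset.mem_filter] at hz ⊢
    exact ⟨hz.1, hz.2.trans hyx⟩
  · intro h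
    refine Finset.card_lt_card (Finset.ssubset_iff_of_subset ?_ |>.2 ⟨y, ?_, ?_⟩)
    · intro z hz
      simp only [Finset.mem_filter] at hz ⊢
      exact ⟨hz.1, hz.2.trans h.le⟩
    · simp [hy]
    · simp [h]

lemma rankIn_injOn (E : Finset ℕ) : Set.InjOn (rankIn E) E := by
  intro x hx y hy h
  have h1 := rankIn_lt_rankIn (x := x) (Finset.mem_coe.1 hy)
  have h2 := rankIn_lt_rankIn (x := y) (Finset.mem_coe.1 hx)
  omega

lemma image_rankIn (E : Finset ℕ) : E.image (rankIn E) = Finset.Icc 1 E.card := by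
  refine Finset.eq_of_subset_of_card_le (fun r hr => ?_) ?_
  · obtain ⟨x, hx, rfl⟩ := Finset.mem_image.1 hr
    rw [Finset.mem_Icc]
    exact ⟨Finset.card_pos.2 ⟨x, by simp [hx]⟩, Finset.card_filter_le _ _⟩
  · rw [Finset.card_image_of_injOn (rankIn_injOn E), Nat.card_Icc, Nat.add_sub_cancel]

lemma card_filter_rankIn (E : Finset ℕ) (p : ℕ → Prop) [DecidablePred p] :
    (E.filter fun x => p (rankIn E x)).card = ((Finset.Icc 1 E.card).filter p).card := by
  rw [← image_rankIn, Finset.filter_image, Finset.card_image_of_injOn]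
  exact (rankIn_injOn E).mono fun x hx => Finset.mem_coe.2 (Finset.mem_filter.1 hx).1

lemma vtype_spec {N : ℕ} (P : Finpartition (Finset.Icc (1 : ℕ) N)) (i : ℕ) :
    (i ∈ (spArcs P).image Prod.fst ↔
      vtype P i = VType.opener ∨ vtype P i = VType.transitory) ∧
    (i ∈ (spArcs P).image Prod.snd ↔
      vtype P i = VType.closer ∨ vtype P i = VType.transitory) := by
  unfold vtype
  split_ifs <;> simp_all

lemma image_spArcs_subset {N : ℕ} (P : Finpartition (Finset.Icc (1 : ℕ) N)) :
    (spArcs P).image Prod.fst ⊆ Finset.Icc 1 N ∧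
      (spArcs P).image Prod.snd ⊆ Finset.Icc 1 N := by
  constructor <;> intro i hi <;> obtain ⟨q, hq, rfl⟩ := Finset.mem_image.1 hi <;>
    have := Finset.mem_product.1 (Finset.mem_filter.1 hq).1
  exacts [this.1, this.2]

/-- A partition has fixed point set `F` and type word `w` on the remaining vertices if and only if
the sets of left and right endpoints of its arcs are those prescribed by `F` and `w`. -/
lemma vtype_eq_word_iff {N : ℕ} {w : ℕ → VType} (hw : ∀ r, w r ≠ VType.fixedpt)
    {F : Finset ℕ} (hF : F ⊆ Finset.Icc 1 N) (P : Finpartition (Finset.Icc (1 : ℕ) N)) :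
    ((Finset.Icc 1 N).filter (fun i => vtype P i = VType.fixedpt) = F ∧
      ∀ i ∈ Finset.Icc 1 N, vtype P i ≠ VType.fixedpt →
        vtype P i =
          w (rankIn ((Finset.Icc 1 N).filter fun x => vtype P x ≠ VType.fixedpt) i)) ↔
    (spArcs P).image Prod.fst = (Finset.Icc 1 N \ F).filter (fun i =>
        w (rankIn (Finset.Icc 1 N \ F) i) = VType.opener ∨
        w (rankIn (Finset.Icc 1 N \ F) i) = VType.transitory) ∧
      (spArcs P).image Prod.snd = (Finset.Icc 1 N \ F).filter (fun i =>
        w (rankIn (Finset.Icc 1 N \ F) i) = VType.closer ∨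
        w (rankIn (Finset.Icc 1 N \ F) i) = VType.transitory) := by
  constructor
  · rintro ⟨hfix, hword⟩
    have hE : (Finset.Icc 1 N).filter (fun x => vtype P x ≠ VType.fixedpt) =
        Finset.Icc 1 N \ F := by
      rw [← hfix, Finset.filter_not]
    rw [hE] at hword
    have hmem : ∀ i, i ∈ Finset.Icc 1 N \ F ↔ i ∈ Finset.Icc 1 N ∧ vtype P i ≠ VType.fixedpt := by
      intro i
      rw [← hE, Finset.mem_filter]
    constructor <;> ext i <;> rw [Finset.mem_filter, hmem]
    · constructor
      · intro hi
        have hN := (image_spArcs_subset P).1 hi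
        have ht := (vtype_spec P i).1.1 hi
        have hne : vtype P i ≠ VType.fixedpt := by rcases ht with h | h <;> simp [h]
        rw [← hword i hN hne]
        exact ⟨⟨hN, hne⟩, ht⟩
      · rintro ⟨⟨hN, hne⟩, ht⟩
        rw [← hword i hN hne] at ht
        exact (vtype_spec P i).1.2 ht
    · constructor
      · intro hi
        have hN := (image_spArcs_subset P).2 hi
        have ht := (vtype_spec P i).2.1 hi
        have hne : vtype P i ≠ VType.fixedpt := by rcases ht with h | h <;> simp [h]
        rw [← hword i hN hne]
        exact ⟨⟨hN, hne⟩, ht⟩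
      · rintro ⟨⟨hN, hne⟩, ht⟩
        rw [← hword i hN hne] at ht
        exact (vtype_spec P i).2.2 ht
  · rintro ⟨hL, hR⟩
    have hval : ∀ i ∈ Finset.Icc 1 N \ F, vtype P i = w (rankIn (Finset.Icc 1 N \ F) i) := by
      intro i hi
      have h := vtype_spec P i
      rw [hL, hR] at h
      simp only [Finset.mem_filter, hi, true_and] at h
      have hne := hw (rankIn (Finset.Icc 1 N \ F) i)
      generalize w (rankIn (Finset.Icc 1 N \ F) i) = u at *
      generalize vtype P i = v at *
      cases u <;> cases v <;> simp at h hne ⊢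
    have hfix : ∀ i ∈ F, vtype P i = VType.fixedpt := by
      intro i hi
      have h := vtype_spec P i
      rw [hL, hR] at h
      simp only [Finset.mem_filter, Finset.mem_sdiff, hi, not_true_eq_false, and_false,
        false_and, false_iff] at h
      generalize vtype P i = v at *
      cases v <;> simp at h ⊢
    have hF' : (Finset.Icc 1 N).filter (fun i => vtype P i = VType.fixedpt) = F := by
      ext i
      rw [Finset.mem_filter]
      refine ⟨fun ⟨hN, h⟩ => ?_, fun hi => ⟨hF hi, hfix i hi⟩⟩
      by_contra hi
      have hi' := Finset.mem_sdiff.2 ⟨hN, hi⟩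
      exact hw _ ((hval i hi').symm.trans h)
    refine ⟨hF', fun i hN hne => ?_⟩
    rw [Finset.filter_not, hF']
    exact hval i (Finset.mem_sdiff.2 ⟨hN, fun hi => hne (hfix i hi)⟩)

/-- The type word `O^(n+k) C^(k-1) T O^(j-1) C^(n+j)`, indexed from `1`. -/
def ococWord (n k j r : ℕ) : VType :=
  if r ≤ n + k then VType.opener
  else if r ≤ n + 2 * k - 1 then VType.closer
  else if r = n + 2 * k then VType.transitory
  else if r ≤ n + 2 * k + j - 1 then VType.opener
  else VType.closer

lemma ococWord_ne_fixedpt (n k j r : ℕ) : ococWord n k j r ≠ VType.fixedpt := by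
  unfold ococWord
  split_ifs <;> simp

lemma ococWord_left_iff {n k j : ℕ} (hk : 1 ≤ k) (hj : 1 ≤ j) (r : ℕ) :
    (ococWord n k j r = VType.opener ∨ ococWord n k j r = VType.transitory) ↔
      r ≤ n + k ∨ n + 2 * k ≤ r ∧ r < n + 2 * k + j := by
  unfold ococWord
  split_ifs <;> simp <;> omega

lemma ococWord_right_iff {n k j : ℕ} (hk : 1 ≤ k) (hj : 1 ≤ j) (r : ℕ) :
    (ococWord n k j r = VType.closer ∨ ococWord n k j r = VType.transitory) ↔
      n + k < r ∧ r ≤ n + 2 * k ∨ n + 2 * k + j ≤ r := by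
  unfold ococWord
  split_ifs <;> simp <;> omega

lemma natCard_subtype_coe_finset (S : Finset ℕ) (p : ℕ → Prop) [DecidablePred p] :
    Nat.card {x : S // p x} = (S.filter p).card := by
  rw [Nat.card_congr (Equiv.subtypeSubtypeEquivSubtypeInter (· ∈ S) p)]
  exact Nat.subtype_card _ fun _ => Finset.mem_filter

/-- The number of partitions whose nonsingleton vertices form the set `E` and have the type word
`ococWord n k j`. -/
lemma card_partitions_ococWord {n k j N : ℕ} (hk : 1 ≤ k) (hj : 1 ≤ j) {E : Finset ℕ}
    (hEN : E ⊆ Finset.Icc 1 N) (hE : E.card = 2 * (n + k + j) - 1) :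
    Nat.card {P : Finpartition (Finset.Icc (1 : ℕ) N) //
      (spArcs P).image Prod.fst = E.filter (fun i =>
        ococWord n k j (rankIn E i) = VType.opener ∨
        ococWord n k j (rankIn E i) = VType.transitory) ∧
      (spArcs P).image Prod.snd = E.filter (fun i =>
        ococWord n k j (rankIn E i) = VType.closer ∨
        ococWord n k j (rankIn E i) = VType.transitory)} =
    (n + k).descFactorial k * (n + j).factorial := by
  simp only [ococWord_left_iff hk hj, ococWord_right_iff hk hj]
  have card_ranks (p : ℕ → Prop) [DecidablePred p] (s : Finset ℕ)
      (h : ∀ r, (1 ≤ r ∧ r ≤ 2 * (n + k + j) - 1) ∧ p r ↔ r ∈ s) :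
      (E.filter fun x => p (rankIn E x)).card = s.card := by
    rw [card_filter_rankIn, hE]
    congr 1
    ext r
    rw [Finset.mem_filter, Finset.mem_Icc, h]
  have hL := card_ranks (fun r => r ≤ n + k ∨ n + 2 * k ≤ r ∧ r < n + 2 * k + j)
    (Finset.Ioc 0 (n + k) ∪ Finset.Ico (n + 2 * k) (n + 2 * k + j)) (by simp; omega)
  have hR := card_ranks (fun r => n + k < r ∧ r ≤ n + 2 * k ∨ n + 2 * k + j ≤ r)
    (Finset.Ioc (n + k) (n + 2 * k) ∪ Finset.Ico (n + 2 * k + j) (2 * (n + k + j)))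
    (by simp; omega)
  rw [Finset.card_union_of_disjoint
    (Finset.disjoint_left.2 fun r => by simp; omega)] at hL hR
  simp only [Nat.card_Ioc, Nat.card_Ico] at hL hR
  let L := E.filter fun x => rankIn E x ≤ n + k ∨
    n + 2 * k ≤ rankIn E x ∧ rankIn E x < n + 2 * k + j
  let R := E.filter fun x => n + k < rankIn E x ∧ rankIn E x ≤ n + 2 * k ∨
    n + 2 * k + j ≤ rankIn E x
  have hRL : R.card = L.card := by
    dsimp only [L, R]
    omega
  rw [card_partitions_with_endpoints (L := L) (R := R) ((Finset.filter_subset _ _).trans hEN)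
    ((Finset.filter_subset _ _).trans hEN) hRL]
  have hiff (f : R ↪ L) : (∀ r, (f r : ℕ) < r) ↔
      ∀ r : R, rankIn E r ≤ n + 2 * k → rankIn E (f r) ≤ n + k := by
    refine forall_congr' fun r => ?_
    obtain ⟨hrE, hr⟩ := Finset.mem_filter.1 r.2
    obtain ⟨-, hfr⟩ := Finset.mem_filter.1 (f r).2
    rw [← rankIn_lt_rankIn hrE]
    omega
  rw [Nat.card_congr (Equiv.subtypeEquivRight hiff),
    card_embedding_restricted (fun r : R => rankIn E r ≤ n + 2 * k)
      (fun a : L => rankIn E a ≤ n + k) (by simpa using hRL)]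
  have h₁ := card_ranks (fun r => (r ≤ n + k ∨ n + 2 * k ≤ r ∧ r < n + 2 * k + j) ∧ r ≤ n + k)
    (Finset.Ioc 0 (n + k)) (by simp; omega)
  have h₂ := card_ranks (fun r => (n + k < r ∧ r ≤ n + 2 * k ∨ n + 2 * k + j ≤ r) ∧
    r ≤ n + 2 * k) (Finset.Ioc (n + k) (n + 2 * k)) (by simp; omega)
  have h₃ := card_ranks (fun r => (n + k < r ∧ r ≤ n + 2 * k ∨ n + 2 * k + j ≤ r) ∧
    ¬r ≤ n + 2 * k) (Finset.Ico (n + 2 * k + j) (2 * (n + k + j))) (by simp; omega)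
  rw [natCard_subtype_coe_finset _ (fun a => rankIn E a ≤ n + k),
    natCard_subtype_coe_finset _ (fun r => rankIn E r ≤ n + 2 * k),
    natCard_subtype_coe_finset _ (fun r => ¬rankIn E r ≤ n + 2 * k),
    Finset.filter_filter, Finset.filter_filter, Finset.filter_filter, h₁, h₂, h₃]
  simp only [Nat.card_Ioc, Nat.card_Ico]
  congr 2 <;> omega

theorem stmt8 (n k j l : ℕ) (hn : 1 ≤ n) (hk : 1 ≤ k) (hj : 1 ≤ j) :
    Nat.card {P : Finpartition (Finset.Icc (1 : ℕ) (2 * (n + k + j) - 1 + l)) //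
      ((Finset.Icc (1 : ℕ) (2 * (n + k + j) - 1 + l)).filter
          fun i => vtype P i = VType.fixedpt).card = l ∧
      vtype P 1 ≠ VType.fixedpt ∧
      vtype P (2 * (n + k + j) - 1 + l) ≠ VType.fixedpt ∧
      ∀ i ∈ Finset.Icc (1 : ℕ) (2 * (n + k + j) - 1 + l), vtype P i ≠ VType.fixedpt →
        vtype P i =
          (if rankIn ((Finset.Icc (1 : ℕ) (2 * (n + k + j) - 1 + l)).filter
              fun x => vtype P x ≠ VType.fixedpt) i ≤ n + k then VType.opener
          else if rankIn ((Finset.Icc (1 : ℕ) (2 * (n + k + j) - 1 + l)).filter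
              fun x => vtype P x ≠ VType.fixedpt) i ≤ n + 2 * k - 1 then VType.closer
          else if rankIn ((Finset.Icc (1 : ℕ) (2 * (n + k + j) - 1 + l)).filter
              fun x => vtype P x ≠ VType.fixedpt) i = n + 2 * k then VType.transitory
          else if rankIn ((Finset.Icc (1 : ℕ) (2 * (n + k + j) - 1 + l)).filter
              fun x => vtype P x ≠ VType.fixedpt) i ≤ n + 2 * k + j - 1 then VType.opener
          else VType.closer)} =
    n.factorial * ((n + k).choose k) * k.factorial * ((n + j).choose j) * j.factorial *
      ((2 * (n + k + j - 1) + l - 1).choose l) := by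
  have hw := ococWord_ne_fixedpt n k j
  let N := 2 * (n + k + j) - 1 + l
  classical
  let good (P : Finpartition (Finset.Icc 1 N)) : Prop :=
    ((Finset.Icc 1 N).filter fun i => vtype P i = VType.fixedpt).card = l ∧
      vtype P 1 ≠ VType.fixedpt ∧ vtype P N ≠ VType.fixedpt ∧
      ∀ i ∈ Finset.Icc 1 N, vtype P i ≠ VType.fixedpt → vtype P i = ococWord n k j
        (rankIn ((Finset.Icc 1 N).filter fun x => vtype P x ≠ VType.fixedpt) i)
  change Nat.card {P // good P} = _
  let fixedPts (P : Finpartition (Finset.Icc 1 N)) : Finset ℕ :=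
    (Finset.Icc 1 N).filter fun i => vtype P i = VType.fixedpt
  have hmaps : ∀ P ∈ Finset.univ.filter good,
      fixedPts P ∈ (Finset.Ioo 1 N).powersetCard l := by
    intro P hP
    obtain ⟨hl, h1, hN, -⟩ := (Finset.mem_filter.1 hP).2
    refine Finset.mem_powersetCard.2 ⟨fun i hi => ?_, hl⟩
    obtain ⟨hi, hfix⟩ := Finset.mem_filter.1 hi
    have hi1 : i ≠ 1 := by rintro rfl; exact h1 hfix
    have hiN : i ≠ N := by rintro rfl; exact hN hfix
    simp only [Finset.mem_Icc, Finset.mem_Ioo] at hi ⊢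
    omega
  have hfiber : ∀ F ∈ (Finset.Ioo 1 N).powersetCard l,
      ((Finset.univ.filter good).filter fun P => fixedPts P = F).card =
        (n + k).descFactorial k * (n + j).factorial := by
    intro F hF
    obtain ⟨hFN, hFl⟩ := Finset.mem_powersetCard.1 hF
    have hFI : F ⊆ Finset.Icc 1 N := hFN.trans Finset.Ioo_subset_Icc_self
    have hcard : (Finset.Icc 1 N \ F).card = 2 * (n + k + j) - 1 := by
      rw [Finset.card_sdiff_of_subset hFI, Nat.card_Icc, hFl]
      omega
    rw [← card_partitions_ococWord hk hj Finset.sdiff_subset hcard, Nat.card_eq_fintype_card,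
      Fintype.card_subtype, Finset.filter_filter]
    congr 1
    ext P
    simp only [Finset.mem_filter, Finset.mem_univ, true_and]
    rw [← vtype_eq_word_iff hw hFI]
    constructor
    · rintro ⟨⟨-, -, -, h⟩, hfix⟩
      exact ⟨hfix, h⟩
    · rintro ⟨hfix, h⟩
      have hnot : ∀ i ∈ Finset.Icc 1 N, i ∉ Finset.Ioo 1 N → vtype P i ≠ VType.fixedpt :=
        fun i hi hi' hv => hi' (hFN (hfix ▸ Finset.mem_filter.2 ⟨hi, hv⟩))
      have hN1 : 1 ≤ N := by omega
      exact ⟨⟨hfix ▸ hFl, hnot 1 (by simp [hN1]) (by simp), hnot N (by simp [hN1]) (by simp), h⟩,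
        hfix⟩
  rw [Nat.card_eq_fintype_card, Fintype.card_subtype, Finset.card_eq_sum_card_fiberwise hmaps,
    Finset.sum_congr rfl hfiber, Finset.sum_const, Finset.card_powersetCard, Nat.card_Ioo,
    smul_eq_mul, Nat.descFactorial_eq_factorial_mul_choose,
    show N - 1 - 1 = 2 * (n + k + j - 1) + l - 1 by omega,
    ← Nat.add_choose_mul_factorial_mul_factorial n j]
  ring
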